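/- arXiv:2111.07216 — 2 statements merged into one kernel-verified Lean document; each statement's English description precedes it below -/
import Mathlib

section
/- Let M be a compact metric space, f : M → M any map, and y, z ∈ M such that lim_{n→∞} d(f^n(y), f^n(z)) = 0. Then for every ε > 0 the pointwise emergences satisfy ℰ_{f,z}(ε) ≤ ℰ_{f,y}(ε). In particular, if the pointwise emergence of f at y is super-polynomial, then so is the pointwise emergence of f at z. -/
open MeasureTheory Filter Set

/-- The first Wasserstein distance between two Borel probability measures on a metric
space: the infimum of `∫ d(x,y) dP` over all couplings `P` of the two measures. -/
noncomputable def wassersteinDist {M : Type*} [MetricSpace M] [MeasurableSpace M]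
    (μ ν : Measure M) : ℝ :=
  sInf { r : ℝ | ∃ P : Measure (M × M), IsProbabilityMeasure P ∧
    P.map Prod.fst = μ ∧ P.map Prod.snd = ν ∧ r = ∫ p, dist p.1 p.2 ∂P }

/-- The `n`-th empirical measure `δ_x^n = (1/n) ∑_{k<n} δ_{f^k x}` of the point `x`. -/
noncomputable def empiricalMeasure {M : Type*} [MetricSpace M] [MeasurableSpace M]
    (f : M → M) (x : M) (n : ℕ) : Measure M :=
  (n : ENNReal)⁻¹ • ∑ k ∈ Finset.range n, Measure.dirac (f^[k] x)

/-- The pointwise emergence `ℰ_{f,x}(ε)`: the least `N ≥ 1` such that there are Borel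
probability measures `μ_1, …, μ_N` with
`limsup_{n→∞} min_{1≤j≤N} d_W(δ_x^n, μ_j) ≤ ε`. -/
noncomputable def pointwiseEmergence {M : Type*} [MetricSpace M] [MeasurableSpace M]
    (f : M → M) (x : M) (ε : ℝ) : ℕ :=
  sInf { N : ℕ | 0 < N ∧ ∃ μs : Fin N → Measure M, (∀ j, IsProbabilityMeasure (μs j)) ∧
    Filter.limsup (fun n : ℕ => ⨅ j, wassersteinDist (empiricalMeasure f x n) (μs j))
      Filter.atTop ≤ ε }

/-- The pointwise emergence of `f` at `x` is super-polynomial: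
`limsup_{ε→0⁺} log ℰ_{f,x}(ε) / (−log ε) = ∞`. -/
def superPolynomialEmergence {M : Type*} [MetricSpace M] [MeasurableSpace M]
    (f : M → M) (x : M) : Prop :=
  Filter.limsup
    (fun ε : ℝ => ((Real.log (pointwiseEmergence f x ε) / (-Real.log ε) : ℝ) : EReal))
    (nhdsWithin 0 (Set.Ioi 0)) = ⊤

section Wasserstein

open scoped ProbabilityTheory

variable {M : Type*} [MetricSpace M] [MeasurableSpace M]

lemma wassersteinDist_nonneg (μ ν : Measure M) : 0 ≤ wassersteinDist μ ν := by
  refine Real.sInf_nonneg ?_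
  rintro r ⟨P, -, -, -, rfl⟩
  exact integral_nonneg fun _ => dist_nonneg

lemma wassersteinDist_le_integral {P : Measure (M × M)} [IsProbabilityMeasure P]
    {μ ν : Measure M} (h₁ : P.map Prod.fst = μ) (h₂ : P.map Prod.snd = ν) :
    wassersteinDist μ ν ≤ ∫ p, dist p.1 p.2 ∂P := by
  refine csInf_le ⟨0, ?_⟩ ⟨P, inferInstance, h₁, h₂, rfl⟩
  rintro r ⟨Q, -, -, -, rfl⟩
  exact integral_nonneg fun _ => dist_nonneg

lemma empiricalMeasure_isProbabilityMeasure (f : M → M) (x : M) {n : ℕ} (hn : n ≠ 0) :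
    IsProbabilityMeasure (empiricalMeasure f x n) := by
  constructor
  simp [empiricalMeasure, ENNReal.inv_mul_cancel, hn]

lemma lintegral_empiricalMeasure (f : M → M) (x : M) (n : ℕ) {g : M → ENNReal}
    (hg : Measurable g) :
    ∫⁻ a, g a ∂(empiricalMeasure f x n)
      = (n : ENNReal)⁻¹ * ∑ k ∈ Finset.range n, g (f^[k] x) := by
  simp [empiricalMeasure, lintegral_finsetSum_measure, lintegral_dirac' _ hg]

variable [CompactSpace M] [BorelSpace M]

lemma integrable_dist (P : Measure (M × M)) [IsFiniteMeasure P] :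
    Integrable (fun p : M × M => dist p.1 p.2) P :=
  continuous_dist.integrable_of_hasCompactSupport (HasCompactSupport.of_compactSpace _)

lemma integrable_dist_left (a : M) (ν : Measure M) [IsFiniteMeasure ν] :
    Integrable (fun w : M => dist a w) ν :=
  (continuous_const.dist continuous_id).integrable_of_hasCompactSupport
    (HasCompactSupport.of_compactSpace _)

lemma wassersteinDist_le_diam (μ ν : Measure M) :
    wassersteinDist μ ν ≤ Metric.diam (univ : Set M) := by
  by_cases h : ∃ P : Measure (M × M), IsProbabilityMeasure P ∧
      P.map Prod.fst = μ ∧ P.map Prod.snd = ν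
  · obtain ⟨P, hP, h₁, h₂⟩ := h
    calc wassersteinDist μ ν ≤ ∫ p, dist p.1 p.2 ∂P := wassersteinDist_le_integral h₁ h₂
      _ ≤ ∫ _, Metric.diam (univ : Set M) ∂P :=
          integral_mono (integrable_dist P) (integrable_const _) fun p =>
            Metric.dist_le_diam_of_mem isCompact_univ.isBounded (mem_univ _) (mem_univ _)
      _ = Metric.diam (univ : Set M) := by simp
  · have hempty : { r : ℝ | ∃ P : Measure (M × M), IsProbabilityMeasure P ∧
        P.map Prod.fst = μ ∧ P.map Prod.snd = ν ∧ r = ∫ p, dist p.1 p.2 ∂P } = ∅ := by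
      rw [eq_empty_iff_forall_notMem]
      rintro r ⟨P, hP, h₁, h₂, -⟩
      exact h ⟨P, hP, h₁, h₂⟩
    rw [wassersteinDist, hempty, Real.sInf_empty]
    exact Metric.diam_nonneg

/-- A coupling of the empirical measure of `y` with `ν` is transported to a coupling of the
empirical measure of `z` with `ν` by moving the atom `f^k y` to `f^k z`. -/
lemma wassersteinDist_empiricalMeasure_le (f : M → M) (y z : M) {n : ℕ} (hn : n ≠ 0)
    (ν : Measure M) [IsProbabilityMeasure ν] :
    wassersteinDist (empiricalMeasure f z n) ν ≤ wassersteinDist (empiricalMeasure f y n) ν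
      + (n : ℝ)⁻¹ * ∑ k ∈ Finset.range n, dist (f^[k] y) (f^[k] z) := by
  have : Nonempty M := ⟨y⟩
  have := empiricalMeasure_isProbabilityMeasure f y hn
  have := empiricalMeasure_isProbabilityMeasure f z hn
  rw [← sub_le_iff_le_add]
  refine le_csInf ⟨_, (empiricalMeasure f y n).prod ν, inferInstance, ?_, ?_, rfl⟩ ?_
  · simp [Measure.map_fst_prod]
  · simp [Measure.map_snd_prod]
  rintro r ⟨P, hP, h₁, h₂, rfl⟩
  rw [sub_le_iff_le_add]
  set κ := P.condKernel
  have hdis : empiricalMeasure f y n ⊗ₘ κ = P := by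
    rw [← h₁]; exact P.disintegrate κ
  let Q : Measure (M × M) :=
    (n : ENNReal)⁻¹ • ∑ k ∈ Finset.range n, (Measure.dirac (f^[k] z)).prod (κ (f^[k] y))
  have hQfst : Q.map Prod.fst = empiricalMeasure f z n := by
    ext s hs
    simp [Q, empiricalMeasure, Measure.map_apply measurable_fst hs, ← prod_univ,
      Measure.prod_prod]
  have hQsnd : Q.map Prod.snd = ν := by
    rw [← h₂, ← hdis]
    ext s hs
    rw [Measure.map_apply measurable_snd hs, Measure.map_apply measurable_snd hs, ← univ_prod,
      Measure.compProd_apply_prod MeasurableSet.univ hs, Measure.restrict_univ,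
      lintegral_empiricalMeasure _ _ _ (κ.measurable_coe hs)]
    simp [Q, Measure.prod_prod]
  have hQ : IsProbabilityMeasure Q := by
    have : IsProbabilityMeasure (Q.map Prod.fst) := by rw [hQfst]; infer_instance
    exact Measure.isProbabilityMeasure_of_map Prod.fst
  have hcostP : ∫ p, dist p.1 p.2 ∂P
      = (n : ℝ)⁻¹ * ∑ k ∈ Finset.range n, ∫ w, dist (f^[k] y) w ∂(κ (f^[k] y)) := by
    rw [← hdis, Measure.integral_compProd (integrable_dist _), empiricalMeasure,
      integral_smul_measure, integral_finsetSum_measure]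
    · simp
    · intro k _
      exact integrable_dirac (by simp)
  have hcostQ : ∫ p, dist p.1 p.2 ∂Q
      = (n : ℝ)⁻¹ * ∑ k ∈ Finset.range n, ∫ w, dist (f^[k] z) w ∂(κ (f^[k] y)) := by
    rw [integral_smul_measure, integral_finsetSum_measure fun k _ => integrable_dist _]
    simp [integral_prod _ (integrable_dist _)]
  refine (wassersteinDist_le_integral hQfst hQsnd).trans ?_
  rw [hcostP, hcostQ, ← mul_add, ← Finset.sum_add_distrib]
  gcongr with k _
  calc ∫ w, dist (f^[k] z) w ∂(κ (f^[k] y))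
      ≤ ∫ w, (dist (f^[k] y) w + dist (f^[k] y) (f^[k] z)) ∂(κ (f^[k] y)) := by
        refine integral_mono (integrable_dist_left _ _)
          ((integrable_dist_left _ _).add (integrable_const _)) fun w => ?_
        have := dist_triangle_left (f^[k] z) w (f^[k] y)
        dsimp only
        linarith
    _ = _ := by
        rw [integral_add (integrable_dist_left _ _) (integrable_const _)]
        simp

lemma limsup_iInf_wassersteinDist_le {f : M → M} {y z : M}
    (h : Tendsto (fun n : ℕ => dist (f^[n] y) (f^[n] z)) atTop (nhds 0))
    {N : ℕ} (hN : 0 < N) (μs : Fin N → Measure M) (hμ : ∀ j, IsProbabilityMeasure (μs j)) :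
    limsup (fun n : ℕ => ⨅ j, wassersteinDist (empiricalMeasure f z n) (μs j)) atTop
      ≤ limsup (fun n : ℕ => ⨅ j, wassersteinDist (empiricalMeasure f y n) (μs j)) atTop := by
  have : Nonempty (Fin N) := ⟨⟨0, hN⟩⟩
  have hnonneg (x : M) (n : ℕ) :
      0 ≤ ⨅ j, wassersteinDist (empiricalMeasure f x n) (μs j) :=
    le_ciInf fun j => wassersteinDist_nonneg _ _
  have hle (x : M) (n : ℕ) : ⨅ j, wassersteinDist (empiricalMeasure f x n) (μs j)
      ≤ Metric.diam (univ : Set M) :=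
    (ciInf_le (Set.finite_range _).bddBelow ⟨0, hN⟩).trans (wassersteinDist_le_diam _ _)
  have hbdd (x : M) : IsBoundedUnder (· ≤ ·) atTop
      (fun n : ℕ => ⨅ j, wassersteinDist (empiricalMeasure f x n) (μs j)) :=
    isBoundedUnder_of ⟨_, hle x⟩
  have hcobdd (x : M) : IsCoboundedUnder (· ≤ ·) atTop
      (fun n : ℕ => ⨅ j, wassersteinDist (empiricalMeasure f x n) (μs j)) :=
    (isBoundedUnder_of ⟨0, hnonneg x⟩ : IsBoundedUnder (· ≥ ·) _ _).isCoboundedUnder_le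
  refine le_of_forall_pos_le_add fun δ hδ => ?_
  refine le_of_forall_gt_imp_ge_of_dense fun c hc => ?_
  have hy := eventually_lt_of_limsup_lt (lt_sub_iff_add_lt.2 hc) (hbdd y)
  have he := h.cesaro.eventually_lt_const hδ
  refine limsup_le_of_le (hcobdd z) ?_
  filter_upwards [hy, he, eventually_ne_atTop 0] with n hyn hen hn
  obtain ⟨j, hj⟩ := exists_lt_of_ciInf_lt hyn
  have := hμ j
  have hz := wassersteinDist_empiricalMeasure_le f y z hn (μs j)
  have := ciInf_le (Set.finite_range
    fun j => wassersteinDist (empiricalMeasure f z n) (μs j)).bddBelow j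
  linarith

lemma pointwiseEmergence_eq_of_asymptotic {f : M → M} {y z : M}
    (h : Tendsto (fun n : ℕ => dist (f^[n] y) (f^[n] z)) atTop (nhds 0)) (ε : ℝ) :
    pointwiseEmergence f z ε = pointwiseEmergence f y ε := by
  have h' : Tendsto (fun n : ℕ => dist (f^[n] z) (f^[n] y)) atTop (nhds 0) := by
    simpa only [dist_comm] using h
  unfold pointwiseEmergence
  congr 1
  ext N
  constructor
  · rintro ⟨hN, μs, hμ, hle⟩
    exact ⟨hN, μs, hμ, (limsup_iInf_wassersteinDist_le h' hN μs hμ).trans hle⟩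
  · rintro ⟨hN, μs, hμ, hle⟩
    exact ⟨hN, μs, hμ, (limsup_iInf_wassersteinDist_le h hN μs hμ).trans hle⟩

end Wasserstein

/-- Let `M` be a compact metric space, `f : M → M` any map, and
`y, z ∈ M` with `d(f^n y, f^n z) → 0`. Then `ℰ_{f,z}(ε) ≤ ℰ_{f,y}(ε)` for every `ε > 0`;
in particular if the pointwise emergence of `f` at `y` is super-polynomial, then so is
the pointwise emergence of `f` at `z`. -/
theorem pointwiseEmergence_le_of_asymptotic
    {M : Type*} [MetricSpace M] [CompactSpace M] [MeasurableSpace M] [BorelSpace M]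
    (f : M → M) (y z : M)
    (h : Filter.Tendsto (fun n : ℕ => dist (f^[n] y) (f^[n] z)) Filter.atTop (nhds 0)) :
    (∀ ε : ℝ, 0 < ε → pointwiseEmergence f z ε ≤ pointwiseEmergence f y ε) ∧
      (superPolynomialEmergence f y → superPolynomialEmergence f z) := by
  refine ⟨fun ε _ => (pointwiseEmergence_eq_of_asymptotic h ε).le, fun hy => ?_⟩
  simpa only [superPolynomialEmergence, pointwiseEmergence_eq_of_asymptotic h] using hy
end

section
/- Let l ≥ 1 be an integer, let χ_1 ≤ χ_2 ≤ … ≤ χ_l be real numbers with χ_1 > 0, let n_1, …, n_l be positive real numbers, let γ_1, …, γ_l be real numbers with 0 ≤ γ_i ≤ n_i for each i, let d ∈ [0,1], and let s ∈ ℝ. If Σ_{i=1}^l χ_i (γ_i − d·n_i) > −s, then Σ_{i=1}^l (γ_i − d·n_i) > −s/χ_1 − (χ_l/χ_1 − 1)(1 − d) Σ_{i=1}^l n_i. -/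
/-- Let `l ≥ 1`, `χ_1 ≤ … ≤ χ_l` with `χ_1 > 0`, `n_i > 0`,
`0 ≤ γ_i ≤ n_i`, `d ∈ [0,1]`, `s ∈ ℝ`. If `∑ χ_i (γ_i − d n_i) > −s`, then
`∑ (γ_i − d n_i) > −s/χ_1 − (χ_l/χ_1 − 1)(1 − d) ∑ n_i`. -/
theorem dimension_defect_estimate
    (l : ℕ) (hl : 1 ≤ l) (χ n γ : Fin l → ℝ)
    (hχmono : Monotone χ) (hχpos : 0 < χ ⟨0, by omega⟩)
    (hn : ∀ i, 0 < n i) (hγ : ∀ i, 0 ≤ γ i ∧ γ i ≤ n i)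
    (d : ℝ) (hd : d ∈ Set.Icc (0 : ℝ) 1) (s : ℝ)
    (h : -s < ∑ i, χ i * (γ i - d * n i)) :
    -s / χ ⟨0, by omega⟩ -
        (χ ⟨l - 1, by omega⟩ / χ ⟨0, by omega⟩ - 1) * (1 - d) * ∑ i, n i <
      ∑ i, (γ i - d * n i) := by
  obtain ⟨-, hd1⟩ := hd
  set a := χ ⟨0, by omega⟩
  set b := χ ⟨l - 1, by omega⟩
  have termwise : ∀ i, χ i * (γ i - d * n i) ≤ a * (γ i - d * n i) + (b - a) * (1 - d) * n i := by
    intro i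
    have ha : a ≤ χ i := hχmono (Fin.le_def.mpr (Nat.zero_le _))
    have hb : χ i ≤ b := hχmono (Fin.le_def.mpr (Nat.le_sub_one_of_lt i.isLt))
    have hx : γ i - d * n i ≤ (1 - d) * n i := by linarith [(hγ i).2]
    have hy : 0 ≤ (1 - d) * n i := mul_nonneg (sub_nonneg.mpr hd1) (hn i).le
    linarith [mul_le_mul_of_nonneg_left hx (sub_nonneg.mpr ha),
      mul_le_mul_of_nonneg_right hb hy]
  have hsum : -s < a * ∑ i, (γ i - d * n i) + (b - a) * (1 - d) * ∑ i, n i := by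
    rw [Finset.mul_sum, Finset.mul_sum, ← Finset.sum_add_distrib]
    exact h.trans_le (Finset.sum_le_sum fun i _ => termwise i)
  have hrw : -s / a - (b / a - 1) * (1 - d) * ∑ i, n i
      = (-s - (b - a) * (1 - d) * ∑ i, n i) / a := by
    field_simp
  rw [hrw, div_lt_iff₀ hχpos]
  linarith
end
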